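/- For all w1, w2 ∈ ℌ and every integer s ≥ 0, one has Z(y w1 (x+y)^s w2 x) = Z(y (x+y)^s (τ(w1) ◇ w2) x). Equivalently, f(y w1, w2 x) = f(y, (τ(w1) ◇ w2) x). -/

import Mathlib

open scoped BigOperators

noncomputable section

/-- `ℌ = ℚ⟨x,y⟩`, the free noncommutative polynomial ring in two indeterminates,
realized as the free `ℚ`-algebra on `Bool` (`false ↦ x`, `true ↦ y`). -/
abbrev H : Type := FreeAlgebra ℚ Bool

/-- The indeterminate `x`. -/
def Hx : H := FreeAlgebra.ι ℚ false

/-- The indeterminate `y`. -/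
def Hy : H := FreeAlgebra.ι ℚ true

/-- The multiple zeta value `ζ(k₁,…,k_r) = ∑_{0<n₁<⋯<n_r} 1/(n₁^{k₁}⋯n_r^{k_r})`. -/
def MZV (r : ℕ) (k : Fin r → ℕ) : ℝ :=
  ∑' n : {n : Fin r → ℕ // (∀ i, 0 < n i) ∧ StrictMono n},
    ∏ i, (1 : ℝ) / (n.1 i : ℝ) ^ (k i)

/-- `Z : yℌx → ℝ` is the `ℚ`-linear map with `Z(y x^{k₁-1} ⋯ y x^{k_r-1}) = ζ(k₁,…,k_r)`.
We encode it as a `ℚ`-linear map on all of `ℌ` whose values on the basis monomials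
`y x^{k₁-1} ⋯ y x^{k_r-1}` (with `k_r ≥ 2`) of `yℌx` are the multiple zeta values;
these values determine `Z` uniquely on the subspace `yℌx`. -/
def IsZetaMap (Z : H →ₗ[ℚ] ℝ) : Prop :=
  ∀ (r : ℕ) (k : Fin (r + 1) → ℕ), (∀ i, 1 ≤ k i) → 2 ≤ k (Fin.last r) →
    Z ((List.ofFn fun i => Hy * Hx ^ (k i - 1)).prod) = MZV (r + 1) k

/-- The family `f(A,B) = (Z(A(x+y)^s B))_{s ≥ 0}`. -/
def fam (Z : H →ₗ[ℚ] ℝ) (A B : H) : ℕ → ℝ := fun s => Z (A * (Hx + Hy) ^ s * B)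

/-- The `ℚ`-bilinear product `◇` on `ℌ`, characterized by its recursive defining
properties (which determine it uniquely). -/
def IsDiamond (d : H →ₗ[ℚ] H →ₗ[ℚ] H) : Prop :=
  (∀ w, d w 1 = w) ∧ (∀ w, d 1 w = w) ∧
  (∀ w1 w2, d (Hx * w1) (Hx * w2) = Hx * d w1 (Hx * w2) - Hx * d (Hy * w1) w2) ∧
  (∀ w1 w2, d (Hx * w1) (Hy * w2) = Hx * d w1 (Hy * w2) + Hy * d (Hx * w1) w2) ∧
  (∀ w1 w2, d (Hy * w1) (Hx * w2) = Hy * d w1 (Hx * w2) + Hx * d (Hy * w1) w2) ∧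
  (∀ w1 w2, d (Hy * w1) (Hy * w2) = Hy * d w1 (Hy * w2) - Hy * d (Hx * w1) w2)

/-- The harmonic product `∗` on `ℌ`, characterized by its recursive defining
properties (which determine it uniquely). -/
def IsHarmonic (st : H →ₗ[ℚ] H →ₗ[ℚ] H) : Prop :=
  (∀ w, st w 1 = w) ∧ (∀ w, st 1 w = w) ∧
  (∀ w1 w2, st (Hx * w1) w2 = Hx * st w1 w2) ∧
  (∀ w1 w2, st w1 (Hx * w2) = Hx * st w1 w2) ∧
  (∀ w1 w2, st (Hy * w1) (Hy * w2) = Hy * (st w1 (Hy * w2) + st (Hy * w1) w2 + Hx * st w1 w2))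

/-- The anti-automorphism `τ` of `ℌ` interchanging `x` and `y`, characterized by
being `ℚ`-linear, anti-multiplicative, unital, and swapping the generators. -/
def IsTau (t : H →ₗ[ℚ] H) : Prop :=
  t 1 = 1 ∧ (∀ a b, t (a * b) = t b * t a) ∧ t Hx = Hy ∧ t Hy = Hx

/-- The automorphism `φ` of `ℌ` with `φ(x) = x + y` and `φ(y) = -y`. -/
def phi : H →ₐ[ℚ] H := FreeAlgebra.lift ℚ (fun b => if b then -Hy else Hx + Hy)

/-- The automorphism `S₁` of `ℌ` with `S₁(x) = x` and `S₁(y) = x + y`. -/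
def S1 : H →ₐ[ℚ] H := FreeAlgebra.lift ℚ (fun b => if b then Hx + Hy else Hx)

/-- The Dirichlet series `∑_{n ≥ 1} a_n / n^s` (with `a n` the coefficient indexed by
`n + 1`) converges to `L` at `s`, i.e. its partial sums tend to `L`. -/
def DSConv (a : ℕ → ℝ) (s : ℕ) (L : ℝ) : Prop :=
  Filter.Tendsto (fun N => ∑ n ∈ Finset.range N, a n / ((n : ℝ) + 1) ^ s)
    Filter.atTop (nhds L)


/-! ### Sequences and their difference arrays -/

/-- The array of iterated differences of a sequence. -/
def arr (c : ℕ → ℝ) : ℕ → ℕ → ℝ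
  | 0, j => c j
  | i + 1, j => arr c i j - arr c i (j + 1)

theorem arr_zero (c : ℕ → ℝ) (j : ℕ) : arr c 0 j = c j := rfl

theorem arr_succ (c : ℕ → ℝ) (i j : ℕ) :
    arr c (i + 1) j = arr c i j - arr c i (j + 1) := rfl

theorem arr_add (c c' : ℕ → ℝ) (i j : ℕ) : arr (c + c') i j = arr c i j + arr c' i j := by
  induction i generalizing j with
  | zero => rfl
  | succ i ih => simp only [arr_succ, ih]; ring

theorem arr_smul (a : ℚ) (c : ℕ → ℝ) (i j : ℕ) : arr (a • c) i j = (a : ℝ) * arr c i j := by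
  induction i generalizing j with
  | zero => simp [arr_zero, Rat.smul_def]
  | succ i ih => simp only [arr_succ, ih]; ring

/-- The operator of prepending `y`. -/
def Ty : (ℕ → ℝ) →ₗ[ℚ] (ℕ → ℝ) where
  toFun c j := c j / (j + 1)
  map_add' c c' := by ext j; simp [add_div]
  map_smul' a c := by ext j; simp [Rat.smul_def, mul_div_assoc]

/-- The operator of prepending `x`. -/
def Tx : (ℕ → ℝ) →ₗ[ℚ] (ℕ → ℝ) where
  toFun c j := (∑ m ∈ Finset.range j, c m) / (j + 1)
  map_add' c c' := by ext j; simp [add_div, Finset.sum_add_distrib]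
  map_smul' a c := by ext j; simp [Rat.smul_def, ← mul_div_assoc, Finset.mul_sum]

/-- The operator of prepending `x + y`. -/
def Tz : (ℕ → ℝ) →ₗ[ℚ] (ℕ → ℝ) := Tx + Ty

theorem Ty_apply (c : ℕ → ℝ) (j : ℕ) : Ty c j = c j / (j + 1) := rfl

theorem Tx_apply (c : ℕ → ℝ) (j : ℕ) : Tx c j = (∑ m ∈ Finset.range j, c m) / (j + 1) := rfl

theorem Tz_apply (c : ℕ → ℝ) (j : ℕ) :
    Tz c j = (∑ m ∈ Finset.range (j + 1), c m) / (j + 1) := by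
  simp [Tz, Tx_apply, Ty_apply, Finset.sum_range_succ, add_div]

theorem arr_y_zero (c : ℕ → ℝ) (j : ℕ) : ((j : ℝ) + 1) * arr (Ty c) 0 j = arr c 0 j := by
  simp only [arr_zero, Ty_apply]; field_simp

theorem arr_y (c : ℕ → ℝ) (i j : ℕ) :
    ((j : ℝ) + 1) * arr (Ty c) (i + 1) j = arr c (i + 1) j + ((i : ℝ) + 1) * arr (Ty c) i (j + 1) := by
  induction i generalizing j with
  | zero =>
    have h1 := arr_y_zero c j
    have h2 := arr_y_zero c (j + 1)
    push_cast at h2 ⊢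
    rw [arr_succ (Ty c), arr_succ c]
    linear_combination h1 - h2
  | succ i ih =>
    have h1 := ih j
    have h2 := ih (j + 1)
    push_cast at h2 ⊢
    have e := arr_succ (Ty c) i (j + 1)
    rw [arr_succ (Ty c) (i + 1), arr_succ c (i + 1)]
    linear_combination h1 - h2 - ((i : ℝ) + 1) * e

theorem arr_z_zero (c : ℕ → ℝ) (i : ℕ) : ((i : ℝ) + 1) * arr (Tz c) i 0 = arr c i 0 ∧
    ∀ j : ℕ, ((i : ℝ) + 1) * arr (Tz c) i (j + 1)
      = arr c i (j + 1) + ((j : ℝ) + 1) * arr (Tz c) (i + 1) j := by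
  induction i with
  | zero =>
    have key : ∀ j : ℕ, ((j : ℝ) + 1) * Tz c j = ∑ m ∈ Finset.range (j + 1), c m := by
      intro j
      rw [Tz_apply]; field_simp
    constructor
    · have := key 0
      simp at this
      simp [arr_zero, this]
    · intro j
      have h1 := key j
      have h2 := key (j + 1)
      rw [Finset.sum_range_succ, ← h1] at h2
      push_cast at h2
      simp only [arr_succ, arr_zero]
      push_cast
      linear_combination h2
  | succ i ih =>
    obtain ⟨h0, h⟩ := ih
    constructor
    · have h1 := h 0
      push_cast at h1 ⊢
      have e := arr_succ (Tz c) i 0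
      have e' := arr_succ c i 0
      linear_combination h0 - h1 + ((i : ℝ) + 1) * e - e'
    · intro j
      have h1 := h j
      have h2 := h (j + 1)
      push_cast at h2 ⊢
      have e := arr_succ (Tz c) (i + 1) j
      have e1 := arr_succ (Tz c) i (j + 1)
      have e' := arr_succ c i (j + 1)
      linear_combination h1 - h2 - ((j : ℝ) + 1) * e + ((i : ℝ) + 2) * e1 - e' - e1

/-- The weight `(n+1)^(-3/4)`. -/
def wt (n : ℕ) : ℝ := ((n : ℝ) + 1) ^ (-(3 / 4) : ℝ)

/-- The fourth root. -/
def rt (n : ℕ) : ℝ := (n : ℝ) ^ ((1 / 4) : ℝ)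

theorem wt_pos (n : ℕ) : 0 < wt n := by unfold wt; positivity

theorem rt_pow (n : ℕ) : rt n ^ 4 = n := by
  unfold rt
  rw [← Real.rpow_natCast, ← Real.rpow_mul (by positivity)]
  norm_num

theorem rt_nonneg (n : ℕ) : 0 ≤ rt n := by unfold rt; positivity

theorem rt_mono (n : ℕ) : rt n ≤ rt (n + 1) := by
  unfold rt
  apply Real.rpow_le_rpow (by positivity) _ (by norm_num)
  push_cast; linarith

theorem rt_eq (n : ℕ) : rt (n + 1) = (n + 1) * wt n := by
  unfold rt wt
  have h : (0 : ℝ) < (n : ℝ) + 1 := by positivity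
  push_cast
  nth_rewrite 2 [← Real.rpow_one ((n : ℝ) + 1)]
  rw [← Real.rpow_add h]
  norm_num

theorem wt_eq (n : ℕ) : wt n * rt (n + 1) ^ 3 = 1 := by
  have h := rt_pow (n + 1)
  have h2 := rt_eq n
  have h3 : (0 : ℝ) < (n : ℝ) + 1 := by positivity
  have : ((n : ℝ) + 1) * (wt n * rt (n + 1) ^ 3) = ((n : ℝ) + 1) * 1 := by
    push_cast at h
    rw [← mul_assoc, ← h2]; linear_combination h
  exact mul_left_cancel₀ h3.ne' this

theorem sum_wt (n : ℕ) : ∑ m ∈ Finset.range n, wt m ≤ 4 * rt n := by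
  induction n with
  | zero => simp; exact rt_nonneg 0
  | succ n ih =>
    rw [Finset.sum_range_succ]
    have h1 := wt_eq n
    have h2 := rt_pow (n + 1)
    have h3 := rt_pow n
    have h4 := rt_mono n
    have h5 := rt_nonneg n
    have hw := wt_pos n
    set a := rt (n + 1)
    set b := rt n
    push_cast at h2
    have h6 : 1 ≤ 4 * (a - b) * a ^ 3 := by
      have : 1 = (a - b) * (a ^ 3 + a ^ 2 * b + a * b ^ 2 + b ^ 3) := by linear_combination h3 - h2
      rw [this]
      have ha : 0 ≤ a := h5.trans h4
      have e1 : a ^ 2 * b ≤ a ^ 2 * a := by gcongr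
      have e2 : a * b ^ 2 ≤ a * a ^ 2 := by gcongr
      have e3 : b ^ 3 ≤ a ^ 3 := by gcongr
      nlinarith [sub_nonneg.2 h4]
    have h7 : wt n * 1 ≤ wt n * (4 * (a - b) * a ^ 3) := by gcongr
    nlinarith

/-- Positive sequences with controlled growth. -/
def Pos (c : ℕ → ℝ) : Prop := (∀ i j, 0 ≤ arr c i j) ∧
  ∃ K : ℝ, 0 ≤ K ∧ (∀ j, c j ≤ K * wt j) ∧ ∀ i, arr c i 0 ≤ K * wt i

/-- Sequences with controlled growth. -/
def Good (c : ℕ → ℝ) : Prop :=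
  ∃ K : ℝ, 0 ≤ K ∧ ∀ i j, |arr c i j| ≤ K * wt j ∧ |arr c i j| ≤ K * wt i

theorem Pos.good {c : ℕ → ℝ} (h : Pos c) : Good c := by
  obtain ⟨h0, K, hK, h1, h2⟩ := h
  refine ⟨K, hK, fun i j => ?_⟩
  rw [abs_of_nonneg (h0 i j)]
  constructor
  · refine le_trans ?_ (h1 j)
    induction i with
    | zero => rfl
    | succ i ih => rw [arr_succ]; linarith [h0 i (j + 1)]
  · refine le_trans ?_ (h2 i)
    induction j with
    | zero => rfl
    | succ j ih => have := arr_succ c i j; linarith [h0 (i + 1) j]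

theorem y_nonneg {c : ℕ → ℝ} (h : ∀ i j, 0 ≤ arr c i j) (i j : ℕ) : 0 ≤ arr (Ty c) i j := by
  induction i generalizing j with
  | zero =>
    have := arr_y_zero c j
    have h1 : (0 : ℝ) < (j : ℝ) + 1 := by positivity
    exact nonneg_of_mul_nonneg_right (this ▸ h 0 j) h1
  | succ i ih =>
    have := arr_y c i j
    have h1 : (0 : ℝ) < (j : ℝ) + 1 := by positivity
    refine nonneg_of_mul_nonneg_right (this ▸ ?_) h1
    have := h (i + 1) j
    have := ih (j + 1)
    positivity

theorem z_nonneg {c : ℕ → ℝ} (h : ∀ i j, 0 ≤ arr c i j) (i j : ℕ) : 0 ≤ arr (Tz c) i j := by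
  induction j generalizing i with
  | zero =>
    have := (arr_z_zero c i).1
    have h1 : (0 : ℝ) < (i : ℝ) + 1 := by positivity
    exact nonneg_of_mul_nonneg_right (this ▸ h i 0) h1
  | succ j ih =>
    have := (arr_z_zero c i).2 j
    have h1 : (0 : ℝ) < (i : ℝ) + 1 := by positivity
    refine nonneg_of_mul_nonneg_right (this ▸ ?_) h1
    have := h i (j + 1)
    have := ih (i + 1)
    positivity

theorem arr_y_col (c : ℕ → ℝ) (i : ℕ) :
    ((i : ℝ) + 1) * arr (Ty c) i 0 = ∑ m ∈ Finset.range (i + 1), arr c m 0 := by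
  induction i with
  | zero => have := arr_y_zero c 0; simpa using this
  | succ i ih =>
    rw [Finset.sum_range_succ, ← ih]
    have h := arr_y c i 0
    have e := arr_succ (Ty c) i 0
    push_cast at h ⊢
    linear_combination h + ((i : ℝ) + 1) * e

theorem div_le_aux {K u : ℝ} {n : ℕ} (hK : 0 ≤ K) (h : ((n : ℝ) + 1) * u ≤ K * wt n) :
    u ≤ (4 * K) * wt n := by
  have hw := wt_pos n
  have : (0 : ℝ) ≤ n := by positivity
  by_contra! hc
  have : 0 ≤ K * wt n := by positivity
  nlinarith

theorem sum_le_aux {K u : ℝ} {n : ℕ} {f : ℕ → ℝ} (hK : 0 ≤ K) (hf : ∀ m, f m ≤ K * wt m)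
    (h : ((n : ℝ) + 1) * u = ∑ m ∈ Finset.range (n + 1), f m) :
    u ≤ (4 * K) * wt n := by
  have h1 : ∑ m ∈ Finset.range (n + 1), f m ≤ K * (4 * rt (n + 1)) := by
    calc _ ≤ ∑ m ∈ Finset.range (n + 1), K * wt m := Finset.sum_le_sum fun m _ => hf m
      _ = K * ∑ m ∈ Finset.range (n + 1), wt m := by rw [Finset.mul_sum]
      _ ≤ _ := by gcongr; exact sum_wt _
  rw [← h, rt_eq] at h1
  have : (0 : ℝ) < (n : ℝ) + 1 := by positivity
  refine le_of_mul_le_mul_left (h1.trans (le_of_eq ?_)) this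
  ring

theorem Pos.y {c : ℕ → ℝ} (h : Pos c) : Pos (Ty c) := by
  obtain ⟨h0, K, hK, h1, h2⟩ := h
  refine ⟨y_nonneg h0, 4 * K, by positivity, fun j => ?_, fun i => ?_⟩
  · exact div_le_aux hK ((arr_y_zero c j).trans_le (h1 j))
  · exact sum_le_aux hK h2 (arr_y_col c i)

theorem Pos.z {c : ℕ → ℝ} (h : Pos c) : Pos (Tz c) := by
  obtain ⟨h0, K, hK, h1, h2⟩ := h
  refine ⟨z_nonneg h0, 4 * K, by positivity, fun j => ?_, fun i => ?_⟩
  · refine sum_le_aux hK h1 ?_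
    rw [Tz_apply]; field_simp
  · exact div_le_aux hK ((arr_z_zero c i).1.trans_le (h2 i))

/-- The delta sequence at zero. -/
def del : ℕ → ℝ := fun j => if j = 0 then 1 else 0

theorem arr_del (i j : ℕ) : arr del i j = if j = 0 then 1 else 0 := by
  induction i generalizing j with
  | zero => rfl
  | succ i ih => rw [arr_succ, ih, ih]; simp

/-- The base sequence `1/(j+1)`. -/
def c1 : ℕ → ℝ := Tz del

theorem c1_apply (j : ℕ) : c1 j = 1 / (j + 1) := by
  simp [c1, Tz_apply, del]

theorem wt_ge (n : ℕ) : 1 ≤ ((n : ℝ) + 1) * wt n := by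
  rw [← rt_eq]
  unfold rt
  exact Real.one_le_rpow (by push_cast; linarith [(Nat.cast_nonneg n : (0 : ℝ) ≤ n)]) (by norm_num)

theorem c1_pos : Pos c1 := by
  have aux : ∀ (n : ℕ) (u : ℝ), ((n : ℝ) + 1) * u = 1 → u ≤ 1 * wt n := by
    intro n u h
    have : (0 : ℝ) < (n : ℝ) + 1 := by positivity
    refine le_of_mul_le_mul_left ?_ this
    rw [h, one_mul]; exact wt_ge n
  refine ⟨z_nonneg fun i j => ?_, 1, by norm_num, fun j => aux j _ ?_, fun i => aux i _ ?_⟩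
  · rw [arr_del]; split_ifs <;> norm_num
  · rw [c1_apply]; field_simp
  · rw [c1, (arr_z_zero del i).1, arr_del]; simp

theorem Good.add {c c' : ℕ → ℝ} (h : Good c) (h' : Good c') : Good (c + c') := by
  obtain ⟨K, hK, h⟩ := h
  obtain ⟨K', hK', h'⟩ := h'
  refine ⟨K + K', by positivity, fun i j => ?_⟩
  rw [arr_add, add_mul, add_mul]
  exact ⟨(abs_add_le _ _).trans (add_le_add (h i j).1 (h' i j).1),
    (abs_add_le _ _).trans (add_le_add (h i j).2 (h' i j).2)⟩

theorem Good.smul {c : ℕ → ℝ} (a : ℚ) (h : Good c) : Good (a • c) := by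
  obtain ⟨K, hK, h⟩ := h
  refine ⟨|(a : ℝ)| * K, by positivity, fun i j => ?_⟩
  rw [arr_smul, abs_mul, mul_assoc, mul_assoc]
  exact ⟨by gcongr; exact (h i j).1, by gcongr; exact (h i j).2⟩

/-! ### The functional `E` -/

/-- The weighted row sums. -/
def EE (c : ℕ → ℝ) (i : ℕ) : ℝ := ∑' j : ℕ, arr c i j / (j + 1)

/-- The partial column sums. -/
def QQ (c : ℕ → ℝ) (i : ℕ) : ℝ := ∑ m ∈ Finset.range i, arr c m 0

/-- The summability needed for `EE`. -/
def Sm (c : ℕ → ℝ) : Prop := ∀ i, Summable fun j : ℕ => arr c i j / ((j : ℝ) + 1)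

theorem wt_div (j : ℕ) : wt j / ((j : ℝ) + 1) = ((j : ℝ) + 1) ^ (-(7 / 4) : ℝ) := by
  unfold wt
  have h : (0 : ℝ) < (j : ℝ) + 1 := by positivity
  nth_rewrite 2 [← Real.rpow_one ((j : ℝ) + 1)]
  rw [← Real.rpow_sub h]
  norm_num

theorem summable_aux (a : ℝ) (ha : a < -1) : Summable fun j : ℕ => ((j : ℝ) + 1) ^ a := by
  have := (summable_nat_add_iff 1).2 (Real.summable_nat_rpow.2 ha)
  simpa using this

theorem Good.sm {c : ℕ → ℝ} (h : Good c) : Sm c := by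
  obtain ⟨K, hK, h⟩ := h
  intro i
  refine Summable.of_norm_bounded ((summable_aux (-(7 / 4)) (by norm_num)).mul_left K) fun j => ?_
  rw [← wt_div, Real.norm_eq_abs, abs_div, abs_of_pos (by positivity : (0 : ℝ) < (j : ℝ) + 1),
    ← mul_div_assoc]
  gcongr
  exact (h i j).1

theorem del_sm : Sm del := by
  intro i
  refine summable_of_ne_finset_zero (s := {0}) fun j hj => ?_
  simp at hj
  simp [arr_del, hj]

theorem wt_tendsto : Filter.Tendsto wt Filter.atTop (nhds 0) := by
  have h := tendsto_rpow_neg_atTop (y := 3 / 4) (by norm_num)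
  have h2 := Filter.tendsto_atTop_add_const_right Filter.atTop (1 : ℝ)
    (tendsto_natCast_atTop_atTop (R := ℝ))
  exact h.comp h2

theorem Good.row_tendsto {c : ℕ → ℝ} (h : Good c) (i : ℕ) :
    Filter.Tendsto (fun j => arr c i j) Filter.atTop (nhds 0) := by
  obtain ⟨K, hK, h⟩ := h
  refine squeeze_zero_norm (fun j => (h i j).1) ?_
  simpa using wt_tendsto.const_mul K

theorem EE_diff {c : ℕ → ℝ} (h : Sm c) (i : ℕ) :
    HasSum (fun j : ℕ => arr c i (j + 1) / ((j : ℝ) + 1)) (EE c i - EE c (i + 1)) := by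
  have := (h i).hasSum.sub (h (i + 1)).hasSum
  refine this.congr_fun fun j => ?_
  rw [arr_succ]; ring

theorem row_hasSum {c : ℕ → ℝ} (h : Good c) (i : ℕ)
    (hs : Summable fun j => arr c (i + 1) j) : HasSum (fun j => arr c (i + 1) j) (arr c i 0) := by
  have h1 := hs.hasSum.tendsto_sum_nat
  have h2 : ∀ n, ∑ j ∈ Finset.range n, arr c (i + 1) j = arr c i 0 - arr c i n := by
    intro n
    simp only [arr_succ]
    exact Finset.sum_range_sub' (fun j => arr c i j) n
  simp only [h2] at h1
  have h3 := (h.row_tendsto i).const_sub (arr c i 0)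
  rw [sub_zero] at h3
  have := tendsto_nhds_unique h1 h3
  rw [← this]; exact hs.hasSum

theorem EE_z {c : ℕ → ℝ} (h : Sm c) (hz : Good (Tz c)) (i : ℕ) :
    ((i : ℝ) + 1) * (EE (Tz c) (i + 1) - EE (Tz c) i) + arr (Tz c) i 0 = EE c (i + 1) - EE c i := by
  have h1 := (EE_diff hz.sm i).mul_left ((i : ℝ) + 1)
  have h2 := EE_diff h i
  have h3 := h1.sub h2
  have h4 : HasSum (fun j => arr (Tz c) (i + 1) j) (((i : ℝ) + 1) * (EE (Tz c) i - EE (Tz c) (i + 1)) -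
      (EE c i - EE c (i + 1))) := by
    refine h3.congr_fun fun j => ?_
    have := (arr_z_zero c i).2 j
    field_simp
    linear_combination -this
  have h5 := (row_hasSum hz i h4.summable).unique h4
  linear_combination h5

theorem EE_y {c : ℕ → ℝ} (h : Sm c) (hy : Good (Ty c)) (i : ℕ) :
    ((i : ℝ) + 1) * (EE (Ty c) (i + 1) - EE (Ty c) i) + arr (Ty c) i 0 = EE c (i + 1) := by
  have h1 := (EE_diff hy.sm i).mul_left ((i : ℝ) + 1)
  have h2 : HasSum (fun j : ℕ => arr c (i + 1) j / ((j : ℝ) + 1)) (EE c (i + 1)) := (h (i + 1)).hasSum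
  have h3 := h1.add h2
  have h4 : HasSum (fun j => arr (Ty c) (i + 1) j) (((i : ℝ) + 1) * (EE (Ty c) i - EE (Ty c) (i + 1)) +
      EE c (i + 1)) := by
    refine h3.congr_fun fun j => ?_
    have := arr_y c i j
    field_simp
    linear_combination this
  have h5 := (row_hasSum hy i h4.summable).unique h4
  linear_combination h5

theorem Good.EE_bound {c : ℕ → ℝ} (h : Good c) :
    ∃ K : ℝ, 0 ≤ K ∧ ∀ i : ℕ, |EE c i| ≤ K * ((i : ℝ) + 1) ^ (-(3 / 8) : ℝ) := by
  obtain ⟨K, hK, h⟩ := h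
  have hs := summable_aux (-(11 / 8)) (by norm_num)
  refine ⟨K * ∑' j : ℕ, ((j : ℝ) + 1) ^ (-(11 / 8) : ℝ), ?_, fun i => ?_⟩
  · have : 0 ≤ ∑' j : ℕ, ((j : ℝ) + 1) ^ (-(11 / 8) : ℝ) := tsum_nonneg fun j => by positivity
    positivity
  have key : ∀ j : ℕ, ‖arr c i j / ((j : ℝ) + 1)‖ ≤
      (K * ((i : ℝ) + 1) ^ (-(3 / 8) : ℝ)) * ((j : ℝ) + 1) ^ (-(11 / 8) : ℝ) := by
    intro j
    have hi : (0 : ℝ) < (i : ℝ) + 1 := by positivity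
    have hj : (0 : ℝ) < (j : ℝ) + 1 := by positivity
    have hb : |arr c i j| ≤ K * (((i : ℝ) + 1) ^ (-(3 / 8) : ℝ) * ((j : ℝ) + 1) ^ (-(3 / 8) : ℝ)) := by
      have e1 : wt i = (((i : ℝ) + 1) ^ (-(3 / 8) : ℝ)) ^ 2 := by
        unfold wt
        rw [← Real.rpow_natCast, ← Real.rpow_mul hi.le]; norm_num
      have e2 : wt j = (((j : ℝ) + 1) ^ (-(3 / 8) : ℝ)) ^ 2 := by
        unfold wt
        rw [← Real.rpow_natCast, ← Real.rpow_mul hj.le]; norm_num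
      obtain ⟨b1, b2⟩ := h i j
      rw [e2] at b1
      rw [e1] at b2
      have hu : 0 < ((i : ℝ) + 1) ^ (-(3 / 8) : ℝ) := by positivity
      have hv : 0 < ((j : ℝ) + 1) ^ (-(3 / 8) : ℝ) := by positivity
      set u := ((i : ℝ) + 1) ^ (-(3 / 8) : ℝ)
      set v := ((j : ℝ) + 1) ^ (-(3 / 8) : ℝ)
      rcases le_total u v with huv | huv
      · refine b2.trans ?_
        rw [sq]; gcongr
      · refine b1.trans ?_
        rw [sq]; gcongr
    rw [Real.norm_eq_abs, abs_div, abs_of_pos hj, div_le_iff₀ hj]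
    refine hb.trans (le_of_eq ?_)
    have : ((j : ℝ) + 1) ^ (-(3 / 8) : ℝ) = ((j : ℝ) + 1) ^ (-(11 / 8) : ℝ) * ((j : ℝ) + 1) := by
      nth_rewrite 3 [← Real.rpow_one ((j : ℝ) + 1)]
      rw [← Real.rpow_add hj]; norm_num
    rw [this]; ring
  have := tsum_of_norm_bounded (hs.hasSum.mul_left (K * ((i : ℝ) + 1) ^ (-(3 / 8) : ℝ))) key
  rw [Real.norm_eq_abs] at this
  refine this.trans (le_of_eq ?_)
  ring

theorem Good.QQ_bound {c : ℕ → ℝ} (h : Good c) :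
    ∃ K : ℝ, 0 ≤ K ∧ ∀ i : ℕ, |QQ c i| ≤ K * ((i : ℝ) + 1) ^ ((1 / 4) : ℝ) := by
  obtain ⟨K, hK, h⟩ := h
  refine ⟨K * 4, by positivity, fun i => ?_⟩
  unfold QQ
  calc _ ≤ ∑ m ∈ Finset.range i, |arr c m 0| := Finset.abs_sum_le_sum_abs _ _
    _ ≤ ∑ m ∈ Finset.range i, K * wt m := Finset.sum_le_sum fun m _ => (h m 0).2
    _ = K * ∑ m ∈ Finset.range i, wt m := by rw [Finset.mul_sum]
    _ ≤ K * (4 * rt i) := by gcongr; exact sum_wt _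
    _ ≤ K * (4 * rt (i + 1)) := by gcongr; exact rt_mono _
    _ = _ := by unfold rt; push_cast; ring

theorem rpow_tendsto (a : ℝ) (ha : 0 < a) :
    Filter.Tendsto (fun n : ℕ => ((n : ℝ) + 1) ^ (-a)) Filter.atTop (nhds 0) := by
  have h := tendsto_rpow_neg_atTop ha
  have h2 := Filter.tendsto_atTop_add_const_right Filter.atTop (1 : ℝ)
    (tendsto_natCast_atTop_atTop (R := ℝ))
  exact h.comp h2

theorem EE_tendsto {c : ℕ → ℝ} (h : Good c) : Filter.Tendsto (EE c) Filter.atTop (nhds 0) := by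
  obtain ⟨K, hK, h⟩ := h.EE_bound
  refine squeeze_zero_norm (fun j => h j) ?_
  simpa using (rpow_tendsto (3 / 8) (by norm_num)).const_mul K

theorem QE_tendsto {c c' : ℕ → ℝ} (h : Good c) (h' : Good c') :
    Filter.Tendsto (fun i => QQ c i * EE c' i) Filter.atTop (nhds 0) := by
  obtain ⟨K, hK, h⟩ := h.QQ_bound
  obtain ⟨K', hK', h'⟩ := h'.EE_bound
  have key : ∀ i : ℕ, ‖QQ c i * EE c' i‖ ≤ (K * K') * ((i : ℝ) + 1) ^ (-(1 / 8) : ℝ) := by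
    intro i
    rw [norm_mul]
    refine (mul_le_mul (h i) (h' i) (abs_nonneg _) (by positivity)).trans (le_of_eq ?_)
    have hi : (0 : ℝ) < (i : ℝ) + 1 := by positivity
    rw [mul_mul_mul_comm, ← Real.rpow_add hi]
    norm_num
  refine squeeze_zero_norm key ?_
  simpa using (rpow_tendsto (1 / 8) (by norm_num)).const_mul (K * K')

/-! ### Words and induction on `ℌ` -/

theorem H_left_induction (M : Submodule ℚ H) (h1 : (1 : H) ∈ M)
    (hx : ∀ w ∈ M, Hx * w ∈ M) (hy : ∀ w ∈ M, Hy * w ∈ M) (w : H) : w ∈ M := by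
  have key : ∀ a : H, ∀ m ∈ M, a * m ∈ M := by
    intro a
    induction a using FreeAlgebra.induction with
    | grade0 r =>
      intro m hm
      rw [← Algebra.smul_def]
      exact M.smul_mem r hm
    | grade1 b =>
      intro m hm
      cases b
      · exact hx m hm
      · exact hy m hm
    | mul a b iha ihb =>
      intro m hm
      rw [mul_assoc]
      exact iha _ (ihb m hm)
    | add a b iha ihb =>
      intro m hm
      rw [add_mul]
      exact M.add_mem (iha m hm) (ihb m hm)
  simpa using key w 1 h1

/-- Words in two letters `u` and `v`. -/
inductive IsWd (u v : H) : H → Prop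
  | one : IsWd u v 1
  | left (w : H) : IsWd u v w → IsWd u v (u * w)
  | right (w : H) : IsWd u v w → IsWd u v (v * w)

theorem span_left {u v : H} {a : H} (ha : ∀ w, IsWd u v w → a * w ∈ Submodule.span ℚ {w | IsWd u v w})
    (w : H) (hw : w ∈ Submodule.span ℚ {w | IsWd u v w}) :
    a * w ∈ Submodule.span ℚ {w | IsWd u v w} := by
  induction hw using Submodule.span_induction with
  | mem w hw => exact ha w hw
  | zero => simp
  | add p q _ _ hp hq => rw [mul_add]; exact Submodule.add_mem _ hp hq
  | smul r p _ hp => rw [mul_smul_comm]; exact Submodule.smul_mem _ r hp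

theorem span_xy (w : H) : w ∈ Submodule.span ℚ {w | IsWd Hx Hy w} := by
  refine H_left_induction _ (Submodule.subset_span IsWd.one) ?_ ?_ w
  · exact span_left fun w hw => Submodule.subset_span (IsWd.left w hw)
  · exact span_left fun w hw => Submodule.subset_span (IsWd.right w hw)

theorem span_zy (w : H) : w ∈ Submodule.span ℚ {w | IsWd (Hx + Hy) Hy w} := by
  refine H_left_induction _ (Submodule.subset_span IsWd.one) ?_ ?_ w
  · refine span_left fun w hw => ?_
    have : Hx * w = (Hx + Hy) * w - Hy * w := by rw [add_mul, add_sub_cancel_right]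
    rw [this]
    exact Submodule.sub_mem _ (Submodule.subset_span (IsWd.left w hw))
      (Submodule.subset_span (IsWd.right w hw))
  · exact span_left fun w hw => Submodule.subset_span (IsWd.right w hw)

/-- Induction over `ℌ` through the letters `x + y` and `y`. -/
theorem H_zy_induction (M : Submodule ℚ H) (h1 : (1 : H) ∈ M)
    (hz : ∀ w ∈ M, (Hx + Hy) * w ∈ M) (hy : ∀ w ∈ M, Hy * w ∈ M) (w : H) : w ∈ M := by
  refine H_left_induction M h1 (fun w hw => ?_) hy w
  have : Hx * w = (Hx + Hy) * w - Hy * w := by rw [add_mul, add_sub_cancel_right]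
  rw [this]
  exact M.sub_mem (hz w hw) (hy w hw)

/-- The action of `ℌ` on sequences. -/
def rho : H →ₐ[ℚ] Module.End ℚ (ℕ → ℝ) := FreeAlgebra.lift ℚ (fun b => if b then Ty else Tx)

/-- The sequence attached to an element of `ℌ`. -/
def cc (q : H) : ℕ → ℝ := rho q c1

theorem cc_one : cc 1 = c1 := by simp [cc]

theorem cc_x (q : H) : cc (Hx * q) = Tx (cc q) := by
  simp [cc, rho, Hx]

theorem cc_y (q : H) : cc (Hy * q) = Ty (cc q) := by
  simp [cc, rho, Hy]

theorem cc_z (q : H) : cc ((Hx + Hy) * q) = Tz (cc q) := by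
  simp [cc, rho, Hx, Hy, Tz]

theorem cc_add (p q : H) : cc (p + q) = cc p + cc q := by simp [cc]

theorem cc_smul (a : ℚ) (q : H) : cc (a • q) = a • cc q := by simp [cc]

theorem cc_pos {w : H} (h : IsWd (Hx + Hy) Hy w) : Pos (cc w) := by
  induction h with
  | one => rw [cc_one]; exact c1_pos
  | left w _ ih => rw [cc_z]; exact ih.z
  | right w _ ih => rw [cc_y]; exact ih.y

theorem cc_good (q : H) : Good (cc q) := by
  induction span_zy q using Submodule.span_induction with
  | mem w hw => exact (cc_pos hw).good
  | zero =>
    have := Good.smul 0 c1_pos.good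
    simpa [cc] using this
  | add p q _ _ hp hq => rw [cc_add]; exact hp.add hq
  | smul r p _ hp => rw [cc_smul]; exact hp.smul r

/-- The column functional. -/
def bb (i : ℕ) : H →ₗ[ℚ] ℝ where
  toFun q := arr (cc q) i 0
  map_add' p q := by rw [cc_add, arr_add]
  map_smul' a q := by rw [cc_smul, arr_smul, Rat.smul_def]; rfl

/-- The row functional. -/
def ee (i : ℕ) : H →ₗ[ℚ] ℝ where
  toFun q := EE (cc q) i
  map_add' p q := by
    unfold EE
    rw [← ((cc_good p).sm i).tsum_add ((cc_good q).sm i)]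
    refine tsum_congr fun j => ?_
    rw [cc_add, arr_add, add_div]
  map_smul' a q := by
    unfold EE
    rw [Rat.smul_def, RingHom.id_apply, ← tsum_mul_left]
    refine tsum_congr fun j => ?_
    rw [cc_smul, arr_smul, mul_div_assoc]

/-- The derivative of the column functional. -/
def de (i : ℕ) : H →ₗ[ℚ] ℝ := ee (i + 1) - ee i

theorem de_apply (i : ℕ) (q : H) : de i q = ee (i + 1) q - ee i q := rfl

/-- Partial sums of the column functional. -/
def qq (i : ℕ) (q : H) : ℝ := ∑ m ∈ Finset.range i, bb m q

theorem qq_succ (i : ℕ) (q : H) : qq (i + 1) q = qq i q + bb i q := Finset.sum_range_succ _ _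

theorem bb_z (i : ℕ) (q : H) : ((i : ℝ) + 1) * bb i ((Hx + Hy) * q) = bb i q := by
  show ((i : ℝ) + 1) * arr (cc ((Hx + Hy) * q)) i 0 = arr (cc q) i 0
  rw [cc_z]; exact (arr_z_zero _ i).1

theorem bb_y (i : ℕ) (q : H) : ((i : ℝ) + 1) * bb i (Hy * q) = qq (i + 1) q := by
  show ((i : ℝ) + 1) * arr (cc (Hy * q)) i 0 = _
  rw [cc_y]; exact arr_y_col _ i

theorem de_z (i : ℕ) (q : H) :
    ((i : ℝ) + 1) * de i ((Hx + Hy) * q) + bb i ((Hx + Hy) * q) = de i q := by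
  show ((i : ℝ) + 1) * (EE (cc ((Hx + Hy) * q)) (i + 1) - EE (cc ((Hx + Hy) * q)) i)
    + arr (cc ((Hx + Hy) * q)) i 0 = EE (cc q) (i + 1) - EE (cc q) i
  have := cc_good ((Hx + Hy) * q)
  rw [cc_z] at *
  exact EE_z (cc_good q).sm this i

theorem de_y (i : ℕ) (q : H) :
    ((i : ℝ) + 1) * de i (Hy * q) + bb i (Hy * q) = ee (i + 1) q := by
  show ((i : ℝ) + 1) * (EE (cc (Hy * q)) (i + 1) - EE (cc (Hy * q)) i)
    + arr (cc (Hy * q)) i 0 = EE (cc q) (i + 1)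
  have := cc_good (Hy * q)
  rw [cc_y] at *
  exact EE_y (cc_good q).sm this i

theorem bb_one (i : ℕ) : ((i : ℝ) + 1) * bb i 1 = 1 := by
  show ((i : ℝ) + 1) * arr (cc 1) i 0 = 1
  rw [cc_one, c1, (arr_z_zero _ i).1, arr_del]; simp

theorem de_one (i : ℕ) : ((i : ℝ) + 1) * de i 1 + bb i 1 = 0 := by
  show ((i : ℝ) + 1) * (EE (cc 1) (i + 1) - EE (cc 1) i) + arr (cc 1) i 0 = 0
  rw [cc_one, c1, EE_z del_sm c1_pos.good]
  simp [EE, arr_del]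

theorem ee_tendsto (q : H) : Filter.Tendsto (fun i => ee i q) Filter.atTop (nhds 0) :=
  EE_tendsto (cc_good q)

theorem qe_tendsto (p q : H) : Filter.Tendsto (fun i => qq i p * ee i q) Filter.atTop (nhds 0) :=
  QE_tendsto (cc_good p) (cc_good q)

/-! ### The diamond product -/

section diamond

variable {d : H →ₗ[ℚ] H →ₗ[ℚ] H}

theorem d_z_left (hd : IsDiamond d) (p q : H) : d ((Hx + Hy) * p) q = (Hx + Hy) * d p q := by
  obtain ⟨h1, h1', hxx, hxy, hyx, hyy⟩ := hd
  have := H_left_induction (LinearMap.eqLocus (d ((Hx + Hy) * p))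
    ((LinearMap.mulLeft ℚ (Hx + Hy)).comp (d p))) ?_ ?_ ?_ q
  · simpa using this
  · simp [h1]
  · intro w _
    simp only [LinearMap.mem_eqLocus, LinearMap.comp_apply, LinearMap.mulLeft_apply, add_mul,
      map_add, LinearMap.add_apply, hxx, hyx]
    abel
  · intro w _
    simp only [LinearMap.mem_eqLocus, LinearMap.comp_apply, LinearMap.mulLeft_apply, add_mul,
      map_add, LinearMap.add_apply, hxy, hyy]
    abel

theorem d_yy (hd : IsDiamond d) (p q : H) : d (Hy * p) (Hy * q) =
    Hy * (d p (Hy * q) + d (Hy * p) q - (Hx + Hy) * d p q) := by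
  rw [← d_z_left hd]
  obtain ⟨h1, h1', hxx, hxy, hyx, hyy⟩ := hd
  rw [hyy, add_mul Hx Hy p, map_add, LinearMap.add_apply, ← mul_sub]
  congr 1
  abel

theorem d_z_right (hd : IsDiamond d) (p q : H) : d p ((Hx + Hy) * q) = (Hx + Hy) * d p q := by
  have := H_zy_induction (LinearMap.eqLocus (d.flip ((Hx + Hy) * q))
    ((LinearMap.mulLeft ℚ (Hx + Hy)).comp (d.flip q))) ?_ ?_ ?_ p
  · simpa using this
  · simp [hd.2.1]
  · intro w hw
    simp only [LinearMap.mem_eqLocus, LinearMap.comp_apply, LinearMap.mulLeft_apply,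
      LinearMap.flip_apply] at hw ⊢
    rw [d_z_left hd, hw, d_z_left hd]
  · intro w hw
    simp only [LinearMap.mem_eqLocus, LinearMap.comp_apply, LinearMap.mulLeft_apply,
      LinearMap.flip_apply] at hw ⊢
    have e : d (Hy * w) ((Hx + Hy) * q) = d (Hy * w) (Hx * q) + d (Hy * w) (Hy * q) := by
      rw [add_mul, map_add]
    have e2 : d w (Hx * q) = (Hx + Hy) * d w q - d w (Hy * q) := by
      rw [← hw, add_mul, map_add, add_sub_cancel_right]
    rw [e, d_yy hd, hd.2.2.2.2.1, e2]
    simp only [mul_add, add_mul, mul_sub]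
    abel

/-- Compatibility of `◇` with the functionals. -/
def Hom (d : H →ₗ[ℚ] H →ₗ[ℚ] H) (p q : H) : Prop := ∀ i : ℕ,
  bb i (d p q) = ((i : ℝ) + 1) * bb i p * bb i q ∧
  de i (d p q) = bb i p * bb i q + ((i : ℝ) + 1) * (de i p * bb i q + bb i p * de i q)

theorem hom_yy_aux {p q r : H}
    (hb : ∀ i : ℕ, bb i r = ((i : ℝ) + 1) * (bb i p * bb i (Hy * q) + bb i (Hy * p) * bb i q)
      - bb i p * bb i q)
    (he : ∀ i : ℕ, de i r = bb i p * bb i (Hy * q) + bb i (Hy * p) * bb i q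
      + ((i : ℝ) + 1) * (de i p * bb i (Hy * q) + bb i p * de i (Hy * q)
        + de i (Hy * p) * bb i q + bb i (Hy * p) * de i q)
      - (de i p * bb i q + bb i p * de i q)) (i : ℕ) :
    qq i r = qq i p * qq i q ∧ ee i r = qq i p * ee i q + ee i p * qq i q := by
  constructor
  · induction i with
    | zero => simp [qq]
    | succ i ih =>
      rw [qq_succ, ih, hb]
      have h1 := bb_y i p
      have h2 := bb_y i q
      rw [qq_succ] at h1 h2
      rw [qq_succ, qq_succ]
      linear_combination (bb i q) * h1 + (bb i p) * h2
  · have hstep : ∀ i, ee i r - (qq i p * ee i q + ee i p * qq i q) =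
        ee 0 r - (qq 0 p * ee 0 q + ee 0 p * qq 0 q) := by
      intro i
      induction i with
      | zero => rfl
      | succ i ih =>
        rw [← ih]
        have h0 := he i
        have h1 := bb_y i p
        have h2 := bb_y i q
        have h3 := de_y i p
        have h4 := de_y i q
        have h5 := de_apply i r
        have h6 := de_apply i p
        have h7 := de_apply i q
        rw [qq_succ] at h1 h2
        rw [qq_succ, qq_succ]
        linear_combination h0 - h5 + (bb i q) * h3 + (bb i p) * h4 + (de i q) * h1 + (de i p) * h2
          + (qq i p + bb i p) * h7 + (qq i q + bb i q) * h6
          - bb i p * h7 - bb i q * h6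
    have ht : Filter.Tendsto (fun i => ee i r - (qq i p * ee i q + ee i p * qq i q))
        Filter.atTop (nhds 0) := by
      have := (ee_tendsto r).sub ((qe_tendsto p q).add (qe_tendsto q p))
      simp only [add_zero, sub_zero] at this
      refine this.congr fun i => ?_
      ring
    have h0 : ee 0 r - (qq 0 p * ee 0 q + ee 0 p * qq 0 q) = 0 := by
      refine tendsto_nhds_unique ?_ ht
      simp only [hstep]
      exact tendsto_const_nhds
    have := hstep i
    linarith

theorem hom_yy {p q : H} (_hd : IsDiamond d) (h1 : Hom d p (Hy * q)) (h2 : Hom d (Hy * p) q)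
    (h3 : Hom d p q) (i : ℕ) :
    qq i (d p (Hy * q) + d (Hy * p) q - (Hx + Hy) * d p q) = qq i p * qq i q ∧
    ee i (d p (Hy * q) + d (Hy * p) q - (Hx + Hy) * d p q) = qq i p * ee i q + ee i p * qq i q := by
  have hb : ∀ i : ℕ, bb i ((Hx + Hy) * d p q) = bb i p * bb i q := by
    intro i
    have e := bb_z i (d p q)
    have hi : (0 : ℝ) < (i : ℝ) + 1 := by positivity
    apply mul_left_cancel₀ hi.ne'
    rw [e, (h3 i).1]; ring
  apply hom_yy_aux
  · intro i
    rw [map_sub, map_add, (h1 i).1, (h2 i).1, hb]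
    ring
  · intro i
    have e := de_z i (d p q)
    have hi : (0 : ℝ) < (i : ℝ) + 1 := by positivity
    have : de i ((Hx + Hy) * d p q) = de i p * bb i q + bb i p * de i q := by
      apply mul_left_cancel₀ hi.ne'
      rw [hb, (h3 i).2] at e
      linear_combination e
    rw [map_sub, map_add, (h1 i).2, (h2 i).2, this]
    ring

theorem Hom.z_left {p q : H} (hd : IsDiamond d) (h : Hom d p q) : Hom d ((Hx + Hy) * p) q := by
  intro i
  have hi : (0 : ℝ) < (i : ℝ) + 1 := by positivity
  have e1 := bb_z i (d p q)
  have e2 := bb_z i p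
  have e3 := de_z i (d p q)
  have e4 := de_z i p
  obtain ⟨h1, h2⟩ := h i
  rw [d_z_left hd]
  have k1 : bb i ((Hx + Hy) * d p q) = ((i : ℝ) + 1) * bb i ((Hx + Hy) * p) * bb i q := by
    apply mul_left_cancel₀ hi.ne'
    rw [e1, h1, e2]; ring
  refine ⟨k1, ?_⟩
  apply mul_left_cancel₀ hi.ne'
  rw [k1, h2, ← e4] at e3
  rw [← e2] at e3
  linear_combination e3

theorem Hom.z_right {p q : H} (hd : IsDiamond d) (h : Hom d p q) : Hom d p ((Hx + Hy) * q) := by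
  intro i
  have hi : (0 : ℝ) < (i : ℝ) + 1 := by positivity
  have e1 := bb_z i (d p q)
  have e2 := bb_z i q
  have e3 := de_z i (d p q)
  have e4 := de_z i q
  obtain ⟨h1, h2⟩ := h i
  rw [d_z_right hd]
  have k1 : bb i ((Hx + Hy) * d p q) = ((i : ℝ) + 1) * bb i p * bb i ((Hx + Hy) * q) := by
    apply mul_left_cancel₀ hi.ne'
    rw [e1, h1, ← e2]; ring
  refine ⟨k1, ?_⟩
  apply mul_left_cancel₀ hi.ne'
  rw [k1, h2, ← e4] at e3
  rw [← e2] at e3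
  linear_combination e3

theorem Hom.y_y {p q : H} (hd : IsDiamond d) (h1 : Hom d p (Hy * q)) (h2 : Hom d (Hy * p) q)
    (h3 : Hom d p q) : Hom d (Hy * p) (Hy * q) := by
  intro i
  have hi : (0 : ℝ) < (i : ℝ) + 1 := by positivity
  obtain ⟨g1, g2⟩ := hom_yy hd h1 h2 h3 (i + 1)
  rw [d_yy hd]
  generalize d p (Hy * q) + d (Hy * p) q - (Hx + Hy) * d p q = r at *
  have e1 := bb_y i r
  have e2 := bb_y i p
  have e3 := bb_y i q
  have f1 := de_y i r
  have f2 := de_y i p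
  have f3 := de_y i q
  have k1 : bb i (Hy * r) = ((i : ℝ) + 1) * bb i (Hy * p) * bb i (Hy * q) := by
    apply mul_left_cancel₀ hi.ne'
    rw [e1, g1, ← e2, ← e3]; ring
  refine ⟨k1, ?_⟩
  apply mul_left_cancel₀ hi.ne'
  rw [k1, g2, ← e2, ← e3, ← f2, ← f3] at f1
  linear_combination f1

theorem hom_one_left (hd : IsDiamond d) (q : H) : Hom d 1 q := by
  intro i
  rw [hd.2.1]
  have e1 := bb_one i
  have e2 := de_one i
  constructor
  · rw [e1, one_mul]
  · linear_combination (-bb i q) * e2 - de i q * e1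

theorem hom_one_right (hd : IsDiamond d) (q : H) : Hom d q 1 := by
  intro i
  rw [hd.1]
  have e1 := bb_one i
  have e2 := de_one i
  constructor
  · linear_combination (-bb i q) * e1
  · linear_combination (-bb i q) * e2 - de i q * e1

theorem hom_words (hd : IsDiamond d) {p q : H} (hp : IsWd (Hx + Hy) Hy p)
    (hq : IsWd (Hx + Hy) Hy q) : Hom d p q := by
  induction hp generalizing q with
  | one => exact hom_one_left hd q
  | left p _ ih => exact (ih hq).z_left hd
  | right p _ ih =>
    induction hq with
    | one => exact hom_one_right hd _
    | left q _ ihq => exact ihq.z_right hd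
    | right q hq ihq => exact Hom.y_y hd (ih (IsWd.right q hq)) ihq (ih hq)

theorem hom_all (hd : IsDiamond d) (p q : H) : Hom d p q := by
  induction span_zy p using Submodule.span_induction with
  | mem p hp =>
    induction span_zy q using Submodule.span_induction with
    | mem q hq => exact hom_words hd hp hq
    | zero => intro i; simp
    | add a b _ _ ha hb =>
      intro i
      obtain ⟨a1, a2⟩ := ha i
      obtain ⟨b1, b2⟩ := hb i
      simp only [map_add, a1, a2, b1, b2]
      constructor <;> ring
    | smul c a _ ha =>
      intro i
      obtain ⟨a1, a2⟩ := ha i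
      simp only [map_smul, a1, a2, Rat.smul_def]
      constructor <;> ring
  | zero => intro i; simp
  | add a b _ _ ha hb =>
    intro i
    obtain ⟨a1, a2⟩ := ha i
    obtain ⟨b1, b2⟩ := hb i
    simp only [map_add, LinearMap.add_apply, a1, a2, b1, b2]
    constructor <;> ring
  | smul c a _ ha =>
    intro i
    obtain ⟨a1, a2⟩ := ha i
    simp only [map_smul, LinearMap.smul_apply, a1, a2, Rat.smul_def]
    constructor <;> ring

theorem transport_x (hd : IsDiamond d) (p q : H) :
    ee 0 (d (Hx * p) q) = ee 0 (d p (Hy * q)) := by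
  have h := (hom_yy hd (hom_all hd p (Hy * q)) (hom_all hd (Hy * p) q) (hom_all hd p q) 0).2
  rw [← d_z_left hd, add_mul, map_add, LinearMap.add_apply] at h
  simp only [map_sub, map_add, qq, Finset.range_zero, Finset.sum_empty] at h
  linarith

theorem transport_y (hd : IsDiamond d) (p q : H) :
    ee 0 (d (Hy * p) q) = ee 0 (d p (Hx * q)) := by
  have h := transport_x hd p q
  have h2 : ee 0 (d ((Hx + Hy) * p) q) = ee 0 (d p ((Hx + Hy) * q)) := by
    rw [d_z_left hd, d_z_right hd]
  simp only [add_mul, map_add, LinearMap.add_apply] at h2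
  linarith

theorem ee_tau (hd : IsDiamond d) {t : H →ₗ[ℚ] H} (ht : IsTau t) (p : H) :
    ∀ q, ee 0 (d p q) = ee 0 (t p * q) := by
  obtain ⟨t1, tm, tx, ty⟩ := ht
  induction span_xy p using Submodule.span_induction with
  | mem p hp =>
    induction hp with
    | one => intro q; rw [hd.2.1, t1, one_mul]
    | left p _ ih => intro q; rw [transport_x hd, ih, tm, tx, mul_assoc]
    | right p _ ih => intro q; rw [transport_y hd, ih, tm, ty, mul_assoc]
  | zero => simp
  | add a b _ _ ha hb =>
    intro q
    simp only [map_add, LinearMap.add_apply, ha, hb, add_mul]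
  | smul c a _ ha =>
    intro q
    simp only [map_smul, LinearMap.smul_apply, ha, smul_mul_assoc]

end diamond

theorem tau_tau {t : H →ₗ[ℚ] H} (ht : IsTau t) (p : H) : t (t p) = p := by
  obtain ⟨t1, tm, tx, ty⟩ := ht
  induction span_xy p using Submodule.span_induction with
  | mem p hp =>
    induction hp with
    | one => rw [t1, t1]
    | left p _ ih => rw [tm, tm, ih, tx, ty]
    | right p _ ih => rw [tm, tm, ih, ty, tx]
  | zero => simp
  | add a b _ _ ha hb => simp only [map_add, ha, hb]
  | smul c a _ ha => simp only [map_smul, ha]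

/-! ### The link with multiple zeta values -/

/-- Strictly increasing tuples of positive integers. -/
abbrev Tup (r : ℕ) : Type := {n : Fin r → ℕ // (∀ i, 0 < n i) ∧ StrictMono n}

theorem finit_apply {r : ℕ} (k : Fin (r + 1) → ℕ) (i : Fin r) :
    (Fin.init k : Fin r → ℕ) i = k i.castSucc := rfl

theorem snoc_mem {r : ℕ} (n : Tup (r + 1)) (j : ℕ) :
    (∀ i, 0 < (Fin.snoc n.1 (n.1 (Fin.last r) + 1 + j) : Fin (r + 2) → ℕ) i) ∧
      StrictMono (Fin.snoc n.1 (n.1 (Fin.last r) + 1 + j) : Fin (r + 2) → ℕ) := by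
  obtain ⟨n, hp, hm⟩ := n
  constructor
  · intro i
    induction i using Fin.lastCases with
    | last => simp only [Fin.snoc_last]; omega
    | cast i => simpa only [Fin.snoc_castSucc] using hp i
  · rw [Fin.strictMono_iff_lt_succ]
    intro i
    rw [Fin.snoc_castSucc]
    induction i using Fin.lastCases with
    | last => rw [Fin.succ_last, Fin.snoc_last]; dsimp only; omega
    | cast i =>
      rw [Fin.succ_castSucc, Fin.snoc_castSucc]
      exact hm Fin.castSucc_lt_succ

/-- Splitting off the last entry. -/
def tupEquiv (r : ℕ) : Tup (r + 1) × ℕ ≃ Tup (r + 2) where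
  toFun a := ⟨Fin.snoc a.1.1 (a.1.1 (Fin.last r) + 1 + a.2), snoc_mem a.1 a.2⟩
  invFun n := (⟨Fin.init n.1, fun i => n.2.1 _, fun i j h => n.2.2 (Fin.castSucc_lt_castSucc_iff.2 h)⟩,
    n.1 (Fin.last (r + 1)) - n.1 (Fin.last r).castSucc - 1)
  left_inv a := by
    obtain ⟨⟨n, hn⟩, j⟩ := a
    simp only [Fin.init_snoc, Fin.snoc_last, Fin.snoc_castSucc, Prod.mk.injEq, true_and]
    omega
  right_inv n := by
    obtain ⟨n, hp, hm⟩ := n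
    apply Subtype.ext
    have h := hm (Fin.castSucc_lt_last (Fin.last r))
    show Fin.snoc (Fin.init n) (Fin.init n (Fin.last r) + 1 + _) = n
    conv_rhs => rw [← Fin.snoc_init_self n]
    congr 1
    simp only [finit_apply]
    omega

/-- The one-entry tuples. -/
def tupOne : ℕ ≃ Tup 1 where
  toFun j := ⟨fun _ => j + 1, fun _ => Nat.succ_pos _, fun a b h => by
    rw [Subsingleton.elim a b] at h; exact absurd h (lt_irrefl _)⟩
  invFun n := n.1 0 - 1
  left_inv j := rfl
  right_inv n := by
    apply Subtype.ext
    funext i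
    have := n.2.1 0
    rw [Subsingleton.elim i 0]
    show n.1 0 - 1 + 1 = n.1 0
    omega

open scoped ENNReal

theorem tsum_shift (h : ℕ → ℝ≥0∞) (i : ℕ) :
    ∑' j, h (i + 1 + j) = ∑' N, if i < N then h N else 0 := by
  rw [← ENNReal.summable.sum_add_tsum_nat_add' (f := fun N => if i < N then h N else 0) (k := i + 1)]
  rw [Finset.sum_eq_zero, zero_add]
  · refine tsum_congr fun j => ?_
    rw [if_pos (by omega), add_comm]
  · intro N hN
    rw [if_neg]
    have := Finset.mem_range.1 hN
    omega

theorem tsum_tri (a h : ℕ → ℝ≥0∞) :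
    ∑' i, a i * ∑' j, h (i + 1 + j) = ∑' N, (∑ m ∈ Finset.range N, a m) * h N := by
  simp only [tsum_shift, ← ENNReal.tsum_mul_left]
  rw [ENNReal.tsum_comm]
  refine tsum_congr fun N => ?_
  rw [Finset.sum_mul, tsum_eq_sum (s := Finset.range N)]
  · refine Finset.sum_congr rfl fun m hm => ?_
    rw [if_pos (Finset.mem_range.1 hm)]
  · intro m hm
    rw [if_neg (by simpa using hm), mul_zero]

/-- The summand of a multiple zeta value. -/
def trm {r : ℕ} (k : Fin r → ℕ) (n : Fin r → ℕ) : ℝ≥0∞ :=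
  ∏ i, ENNReal.ofReal ((1 : ℝ) / (n i : ℝ) ^ (k i))

/-- The correspondence between indices and words. -/
def Link (t : H →ₗ[ℚ] H) (q : H) (r : ℕ) (k : Fin (r + 1) → ℕ) : Prop :=
  (∀ i, 1 ≤ k i) ∧ Hy * t q = (List.ofFn fun i => Hy * Hx ^ (k i - 1)).prod ∧
  (∀ j, 0 ≤ cc q j) ∧
  ∀ g : ℕ → ℝ≥0∞, ∑' n : Tup (r + 1), trm k n.1 * g (n.1 (Fin.last r))
    = ∑' j : ℕ, ENNReal.ofReal (cc q j) * g (j + 1)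

theorem link_one {t : H →ₗ[ℚ] H} (ht : IsTau t) : Link t 1 0 (fun _ => 1) := by
  refine ⟨fun _ => le_rfl, by simp [ht.1], fun j => ?_, fun g => ?_⟩
  · rw [cc_one, c1_apply]; positivity
  · rw [← tupOne.tsum_eq]
    refine tsum_congr fun j => ?_
    simp [trm, tupOne, cc_one, c1_apply]

theorem link_y {t : H →ₗ[ℚ] H} (ht : IsTau t) {q : H} {r : ℕ} {k : Fin (r + 1) → ℕ}
    (h : Link t q r k) :
    Link t (Hy * q) r (Fin.snoc (Fin.init k) (k (Fin.last r) + 1)) := by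
  obtain ⟨h1, h2, h3, h4⟩ := h
  refine ⟨?_, ?_, fun j => ?_, fun g => ?_⟩
  · intro i
    induction i using Fin.lastCases with
    | last => simp
    | cast i => simpa [finit_apply] using h1 i.castSucc
  · rw [ht.2.1, ht.2.2.2, ← mul_assoc, h2, List.ofFn_succ', List.ofFn_succ']
    simp only [List.concat_eq_append, List.prod_append, List.prod_singleton, Fin.snoc_castSucc,
      Fin.snoc_last, finit_apply, mul_assoc, ← pow_succ]
    have := h1 (Fin.last r)
    congr 4
    omega
  · rw [cc_y, Ty_apply]
    have := h3 j
    positivity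
  · have := h4 fun N => ENNReal.ofReal (1 / (N : ℝ)) * g N
    have e : ∀ n : Fin (r + 1) → ℕ, trm (Fin.snoc (Fin.init k) (k (Fin.last r) + 1)) n
        = trm k n * ENNReal.ofReal (1 / (n (Fin.last r) : ℝ)) := by
      intro n
      simp only [trm, Fin.prod_univ_castSucc, Fin.snoc_castSucc, Fin.snoc_last, finit_apply]
      rw [mul_assoc, ← ENNReal.ofReal_mul (by positivity), pow_succ, one_div_mul_one_div]
    simp only [e, mul_assoc]
    rw [this]
    refine tsum_congr fun j => ?_
    rw [← mul_assoc, ← ENNReal.ofReal_mul (h3 j), cc_y, Ty_apply]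
    push_cast
    rw [mul_one_div]

theorem link_x {t : H →ₗ[ℚ] H} (ht : IsTau t) {q : H} {r : ℕ} {k : Fin (r + 1) → ℕ}
    (h : Link t q r k) :
    Link t (Hx * q) (r + 1) (Fin.snoc k 1) := by
  obtain ⟨h1, h2, h3, h4⟩ := h
  refine ⟨?_, ?_, fun j => ?_, fun g => ?_⟩
  · intro i
    induction i using Fin.lastCases with
    | last => simp
    | cast i => simpa using h1 _
  · rw [ht.2.1, ht.2.2.1, ← mul_assoc, h2, List.ofFn_succ' (n := r + 1)]
    simp only [List.concat_eq_append, List.prod_append, List.prod_singleton, Fin.snoc_castSucc,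
      Fin.snoc_last, Nat.sub_self, pow_zero, mul_one]
  · rw [cc_x, Tx_apply]
    have := Finset.sum_nonneg fun m (_ : m ∈ Finset.range j) => h3 m
    positivity
  · have := h4 fun N => ∑' j : ℕ, ENNReal.ofReal (1 / ((N + 1 + j : ℕ) : ℝ)) * g (N + 1 + j)
    rw [← (tupEquiv r).tsum_eq, ENNReal.tsum_prod']
    have e : ∀ (n : Tup (r + 1)) (j : ℕ),
        trm (Fin.snoc k 1 : Fin (r + 2) → ℕ) (tupEquiv r (n, j)).1 *
          g ((tupEquiv r (n, j)).1 (Fin.last (r + 1)))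
        = trm k n.1 * (ENNReal.ofReal (1 / ((n.1 (Fin.last r) + 1 + j : ℕ) : ℝ))
          * g (n.1 (Fin.last r) + 1 + j)) := by
      intro n j
      simp only [trm, tupEquiv, Equiv.coe_fn_mk]
      rw [Fin.prod_univ_castSucc]
      simp only [Fin.snoc_castSucc, Fin.snoc_last, pow_one, mul_assoc]
    simp only [e, ENNReal.tsum_mul_left]
    rw [this]
    have key := tsum_tri (fun j => ENNReal.ofReal (cc q j))
      (fun N => ENNReal.ofReal (1 / ((N + 1 : ℕ) : ℝ)) * g (N + 1))
    have e2 : ∀ i j : ℕ, i + 1 + j + 1 = i + 1 + 1 + j := by intros; omega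
    simp only [e2] at key
    rw [key]
    refine tsum_congr fun N => ?_
    rw [← ENNReal.ofReal_sum_of_nonneg fun m _ => h3 m, ← mul_assoc, ← ENNReal.ofReal_mul
      (Finset.sum_nonneg fun m _ => h3 m), cc_x, Tx_apply, mul_one_div]
    push_cast
    rfl

theorem link_exists {t : H →ₗ[ℚ] H} (ht : IsTau t) {q : H} (hq : IsWd Hx Hy q) :
    ∃ r k, Link t q r k := by
  induction hq with
  | one => exact ⟨_, _, link_one ht⟩
  | left q _ ih => obtain ⟨r, k, h⟩ := ih; exact ⟨_, _, link_x ht h⟩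
  | right q _ ih => obtain ⟨r, k, h⟩ := ih; exact ⟨_, _, link_y ht h⟩

theorem Z_word {Z : H →ₗ[ℚ] ℝ} (hZ : IsZetaMap Z) {t : H →ₗ[ℚ] H} (ht : IsTau t) {q : H}
    (hq : IsWd Hx Hy q) : Z (Hy * t q * Hx) = ee 0 q := by
  obtain ⟨r, k, h⟩ := link_exists ht hq
  obtain ⟨h1, h2, h3, h4⟩ := link_y ht h
  have hl : Hy * t q * Hx = Hy * t (Hy * q) := by rw [ht.2.1, ht.2.2.2, mul_assoc]
  rw [hl, h2, hZ r _ h1 (by have := h.1 (Fin.last r); simp only [Fin.snoc_last]; omega)]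
  have h5 := congrArg ENNReal.toReal (h4 fun _ => 1)
  simp only [mul_one] at h5
  rw [ENNReal.tsum_toReal_eq, ENNReal.tsum_toReal_eq] at h5
  · unfold MZV
    show _ = ∑' j : ℕ, arr (cc q) 0 j / ((j : ℝ) + 1)
    rw [show (∑' j : ℕ, arr (cc q) 0 j / ((j : ℝ) + 1)) = ∑' j, (ENNReal.ofReal (cc (Hy * q) j)).toReal
      from tsum_congr fun j => by rw [ENNReal.toReal_ofReal (h3 j), cc_y]; rfl]
    rw [← h5]
    refine tsum_congr fun n => ?_
    rw [trm, ENNReal.toReal_prod]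
    refine Finset.prod_congr rfl fun i _ => ?_
    rw [ENNReal.toReal_ofReal (by positivity)]
  · intro j; exact ENNReal.ofReal_ne_top
  · intro n; exact ENNReal.prod_ne_top fun i _ => ENNReal.ofReal_ne_top

theorem Z_tau {Z : H →ₗ[ℚ] ℝ} (hZ : IsZetaMap Z) {t : H →ₗ[ℚ] H} (ht : IsTau t) (q : H) :
    Z (Hy * t q * Hx) = ee 0 q := by
  induction span_xy q using Submodule.span_induction with
  | mem q hq => exact Z_word hZ ht hq
  | zero => simp
  | add a b _ _ ha hb => simp only [map_add, mul_add, add_mul, ha, hb]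
  | smul c a _ ha => simp only [map_smul, mul_smul_comm, smul_mul_assoc, ha]

theorem Z_eq {Z : H →ₗ[ℚ] ℝ} (hZ : IsZetaMap Z) {d : H →ₗ[ℚ] H →ₗ[ℚ] H} (hd : IsDiamond d)
    {t : H →ₗ[ℚ] H} (ht : IsTau t) (q : H) : Z (Hy * q * Hx) = ee 0 q := by
  have h := Z_tau hZ ht (t q)
  rw [tau_tau ht] at h
  rw [h, ← mul_one (t q), ← ee_tau hd ht q 1, hd.1]

theorem d_z_pow {d : H →ₗ[ℚ] H →ₗ[ℚ] H} (hd : IsDiamond d) (s : ℕ) (p q : H) :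
    d ((Hx + Hy) ^ s * p) q = (Hx + Hy) ^ s * d p q := by
  induction s with
  | zero => simp
  | succ s ih => rw [pow_succ', mul_assoc, d_z_left hd, ih, mul_assoc]

theorem tau_z_pow {t : H →ₗ[ℚ] H} (ht : IsTau t) (s : ℕ) (p : H) :
    t ((Hx + Hy) ^ s * p) = t p * (Hx + Hy) ^ s := by
  induction s with
  | zero => simp
  | succ s ih =>
    rw [pow_succ', mul_assoc, ht.2.1, ih, map_add, ht.2.2.1, ht.2.2.2, add_comm Hy Hx, mul_assoc,
      ← pow_succ, pow_succ']

/-- For all `w₁, w₂ ∈ ℌ` and every integer `s ≥ 0`,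
`Z(y w₁ (x+y)^s w₂ x) = Z(y (x+y)^s (τ(w₁) ◇ w₂) x)`;
equivalently, `f(y w₁, w₂ x) = f(y, (τ(w₁) ◇ w₂) x)`. -/
theorem statement0 (Z : H →ₗ[ℚ] ℝ) (hZ : IsZetaMap Z)
    (d : H →ₗ[ℚ] H →ₗ[ℚ] H) (hd : IsDiamond d)
    (t : H →ₗ[ℚ] H) (ht : IsTau t)
    (w1 w2 : H) (s : ℕ) :
    Z (Hy * w1 * (Hx + Hy) ^ s * w2 * Hx)
      = Z (Hy * (Hx + Hy) ^ s * d (t w1) w2 * Hx) := by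
  have h1 : Hy * w1 * (Hx + Hy) ^ s * w2 * Hx
      = Hy * (t ((Hx + Hy) ^ s * t w1) * w2) * Hx := by
    rw [tau_z_pow ht, tau_tau ht]; simp only [mul_assoc]
  have h2 : Hy * (Hx + Hy) ^ s * d (t w1) w2 * Hx
      = Hy * d ((Hx + Hy) ^ s * t w1) w2 * Hx := by
    rw [d_z_pow hd]; simp only [mul_assoc]
  rw [h1, h2, Z_eq hZ hd ht, Z_eq hZ hd ht, ee_tau hd ht]

end
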